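/- For every unitary U on (ℂ^d)^{⊗n}, the magic power is attained on traceless operators: sup{ |H[U O U†] − H[O]| : ‖O‖₂ = 1 } = sup{ |H[U O U†] − H[O]| : ‖O‖₂ = 1 and Tr(O) = 0 }. -/

import Mathlib

open Matrix Complex BigOperators
open scoped ComplexOrder
noncomputable section

namespace QC

/-- Operators on the `n`-qudit space `(ℂ^d)^{⊗n}`, as matrices indexed by
computational basis labels `Fin n → Fin d`. -/
abbrev QOp (d n : ℕ) := Matrix (Fin n → Fin d) (Fin n → Fin d) ℂ

/-- The qudit shift operator `X`, with `X|j⟩ = |j+1 mod d⟩`. -/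
def shiftX (d : ℕ) : Matrix (Fin d) (Fin d) ℂ :=
  fun i j => if (i : ℕ) = ((j : ℕ) + 1) % d then 1 else 0

/-- The qudit clock operator `Z`, with `Z|j⟩ = e^{2πij/d}|j⟩`. -/
def clockZ (d : ℕ) : Matrix (Fin d) (Fin d) ℂ :=
  Matrix.diagonal (fun j => Complex.exp (2 * Real.pi * Complex.I * (j : ℕ) / d))

/-- The single-qudit Pauli operator `P_a = X^s Z^t` for `a = (s,t) ∈ ℤ_d × ℤ_d`. -/
def pauli1 (d : ℕ) (a : ZMod d × ZMod d) : Matrix (Fin d) (Fin d) ℂ :=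
  shiftX d ^ a.1.val * clockZ d ^ a.2.val

/-- The `n`-qudit Pauli operator `P_ā = P_{a_1} ⊗ ⋯ ⊗ P_{a_n}`. -/
def pauliN (d n : ℕ) (a : Fin n → ZMod d × ZMod d) : QOp d n :=
  fun x y => ∏ i, pauli1 d (a i) (x i) (y i)

/-- The weight `|ā|`: the number of indices `i` with `a_i ≠ (0,0)`. -/
def weight (d n : ℕ) (a : Fin n → ZMod d × ZMod d) : ℕ :=
  (Finset.univ.filter (fun i => a i ≠ 0)).card

/-- `P_O[ā] = |Tr(O P_ā)|² / d^{2n}`. -/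
def pdist (d n : ℕ) (O : QOp d n) (a : Fin n → ZMod d × ZMod d) : ℝ :=
  ‖(O * pauliN d n a).trace‖ ^ 2 / (d : ℝ) ^ (2 * n)

/-- The normalized 2-norm `‖O‖₂ = (Tr(O†O)/d^n)^{1/2}`. -/
def l2norm (d n : ℕ) (O : QOp d n) : ℝ :=
  Real.sqrt (((Oᴴ * O).trace).re / (d : ℝ) ^ n)

/-- The total influence `I[O] = Σ_ā |ā|·P_O[ā]`. -/
def influence (d n : ℕ) [NeZero d] (O : QOp d n) : ℝ :=
  ∑ a : Fin n → ZMod d × ZMod d, (weight d n a : ℝ) * pdist d n O a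

/-- The local influence `I_j[O] = Σ_{ā : a_j ≠ 0} P_O[ā]`. -/
def localInfluence (d n : ℕ) [NeZero d] (j : Fin n) (O : QOp d n) : ℝ :=
  ∑ a ∈ Finset.univ.filter (fun a : Fin n → ZMod d × ZMod d => a j ≠ 0), pdist d n O a

/-- The quantum Fourier entropy `H[O] = -Σ_ā P_O[ā] log₂ P_O[ā]` (with `0·log 0 = 0`). -/
def qEntropy (d n : ℕ) [NeZero d] (O : QOp d n) : ℝ :=
  -∑ a : Fin n → ZMod d × ZMod d, pdist d n O a * Real.logb 2 (pdist d n O a)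

/-- The binary entropy `h(x) = -x log₂ x - (1-x) log₂ (1-x)`. -/
def binEntropy (x : ℝ) : ℝ :=
  -(x * Real.logb 2 x) - (1 - x) * Real.logb 2 (1 - x)

/-- Circuit sensitivity `CiS[U] = sup { |I[UOU†] - I[O]| : ‖O‖₂ = 1 }`. -/
def CiS (d n : ℕ) [NeZero d] (U : QOp d n) : ℝ :=
  sSup {x : ℝ | ∃ O : QOp d n, l2norm d n O = 1 ∧
    x = |influence d n (U * O * Uᴴ) - influence d n O|}

/-- Magic power `𝓜[U] = sup { |H[UOU†] - H[O]| : ‖O‖₂ = 1 }`. -/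
def magicPower (d n : ℕ) [NeZero d] (U : QOp d n) : ℝ :=
  sSup {x : ℝ | ∃ O : QOp d n, l2norm d n O = 1 ∧
    x = |qEntropy d n (U * O * Uᴴ) - qEntropy d n O|}

/-- Magic entropy `M[U] = max { H[U P_ā U†] : |ā| = 1 }`. -/
def magicEntropy (d n : ℕ) [NeZero d] (U : QOp d n) : ℝ :=
  sSup {x : ℝ | ∃ a : Fin n → ZMod d × ZMod d, weight d n a = 1 ∧
    x = qEntropy d n (U * pauliN d n a * Uᴴ)}

/-- The operator norm `‖A‖∞` (the L2 → L2 operator norm). -/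
def opNorm (d n : ℕ) (A : QOp d n) : ℝ :=
  ‖Matrix.toEuclideanCLM (𝕜 := ℂ) (n := Fin n → Fin d) A‖

/-- The influence rate `R_I(H,O)`. -/
def influenceRate (d n : ℕ) [NeZero d] (H O : QOp d n) : ℂ :=
  (Complex.I / (d : ℂ) ^ (2 * n)) * ∑ a : Fin n → ZMod d × ZMod d, (weight d n a : ℂ) *
    (((O * H - H * O) * pauliN d n a).trace * (O * (pauliN d n a)ᴴ).trace +
     ((O * H - H * O) * (pauliN d n a)ᴴ).trace * (O * pauliN d n a).trace)

/-- The magic rate `R_M(H,O)`. -/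
def magicRate (d n : ℕ) [NeZero d] (H O : QOp d n) : ℂ :=
  (Complex.I / (d : ℂ) ^ (2 * n)) * ∑ a : Fin n → ZMod d × ZMod d,
    (((O * H - H * O) * pauliN d n a).trace * (O * (pauliN d n a)ᴴ).trace +
     ((O * H - H * O) * (pauliN d n a)ᴴ).trace * (O * pauliN d n a).trace) *
    (Real.logb 2 (pdist d n O a) : ℂ)

/-- Extend an operator on the first `k` qudits by the identity: `H₀ ⊗ I`. -/
def extendOp (d k n : ℕ) (h : k ≤ n) (H0 : QOp d k) : QOp d n :=
  fun x y => if ∀ i : Fin n, k ≤ (i : ℕ) → x i = y i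
    then H0 (fun i => x (Fin.castLE h i)) (fun i => y (Fin.castLE h i)) else 0

/-- The tensor product `A ⊗ B` of an `n₁`-qudit and an `n₂`-qudit operator. -/
def tensorOp (d n₁ n₂ : ℕ) (A : QOp d n₁) (B : QOp d n₂) : QOp d (n₁ + n₂) :=
  fun x y => A (fun i => x (Fin.castAdd n₂ i)) (fun i => y (Fin.castAdd n₂ i)) *
             B (fun i => x (Fin.natAdd n₁ i)) (fun i => y (Fin.natAdd n₁ i))

/-- Embed a single-qudit operator `W` at position `j` (identity elsewhere). -/
def embedAt (d n : ℕ) (j : Fin n) (W : Matrix (Fin d) (Fin d) ℂ) : QOp d n :=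
  fun x y => if ∀ i, i ≠ j → x i = y i then W (x j) (y j) else 0

/-- The swap unitary exchanging qudits `i` and `j`. -/
def swapOp (d n : ℕ) (i j : Fin n) : QOp d n :=
  fun x y => if x = y ∘ Equiv.swap i j then 1 else 0

/-- The qubit Pauli X matrix. -/
def pauliX : Matrix (Fin 2) (Fin 2) ℂ := !![0, 1; 1, 0]

/-- The qubit Pauli Y matrix. -/
def pauliY : Matrix (Fin 2) (Fin 2) ℂ := !![0, -Complex.I; Complex.I, 0]

/-- The qubit Pauli Z matrix. -/
def pauliZ : Matrix (Fin 2) (Fin 2) ℂ := !![1, 0; 0, -1]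

/-- The ordered product `γ^S = ∏_{i∈S} γ_i` (factors in increasing index order). -/
def gammaProd (n : ℕ) (γ : Fin (2 * n) → QOp 2 n) (S : Finset (Fin (2 * n))) : QOp 2 n :=
  ((S.sort (· ≤ ·)).map γ).prod

/-- `P^G_O[S] = |Tr((γ^S)† O)|² / 2^{2n}`. -/
def pdistG (n : ℕ) (γ : Fin (2 * n) → QOp 2 n) (O : QOp 2 n) (S : Finset (Fin (2 * n))) : ℝ :=
  ‖((gammaProd n γ S)ᴴ * O).trace‖ ^ 2 / (2 : ℝ) ^ (2 * n)

/-- The Gaussian influence `I^G[O] = Σ_S |S|·P^G_O[S]`. -/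
def influenceG (n : ℕ) (γ : Fin (2 * n) → QOp 2 n) (O : QOp 2 n) : ℝ :=
  ∑ S : Finset (Fin (2 * n)), (S.card : ℝ) * pdistG n γ O S

/-- The Gaussian Fourier entropy `H^G[O] = -Σ_S P^G_O[S] log₂ P^G_O[S]`. -/
def entropyG (n : ℕ) (γ : Fin (2 * n) → QOp 2 n) (O : QOp 2 n) : ℝ :=
  -∑ S : Finset (Fin (2 * n)), pdistG n γ O S * Real.logb 2 (pdistG n γ O S)

/-- Gaussian circuit sensitivity `CiS^G[U] = sup { |I^G[UOU†] - I^G[O]| : ‖O‖₂ = 1 }`. -/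
def CiSG (n : ℕ) (γ : Fin (2 * n) → QOp 2 n) (U : QOp 2 n) : ℝ :=
  sSup {x : ℝ | ∃ O : QOp 2 n, l2norm 2 n O = 1 ∧
    x = |influenceG n γ (U * O * Uᴴ) - influenceG n γ O|}

/-- Fourier coefficient `f̂(S)` of a Boolean function `f : {-1,1}^n → ℝ`, with
the domain encoded as `Fin n → Bool` (`true ↦ -1`, `false ↦ 1`). -/
def fourierCoeff (n : ℕ) (f : (Fin n → Bool) → ℝ) (S : Finset (Fin n)) : ℝ :=
  (∑ x : Fin n → Bool, f x * ∏ i ∈ S, (if x i then -1 else 1)) / 2 ^ n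

/-- Fourier entropy of a Boolean function. -/
def boolEntropy (n : ℕ) (f : (Fin n → Bool) → ℝ) : ℝ :=
  -∑ S : Finset (Fin n), (fourierCoeff n f S) ^ 2 * Real.logb 2 ((fourierCoeff n f S) ^ 2)

/-- Total influence of a Boolean function. -/
def boolInfluence (n : ℕ) (f : (Fin n → Bool) → ℝ) : ℝ :=
  ∑ S : Finset (Fin n), (S.card : ℝ) * (fourierCoeff n f S) ^ 2

/-- The completely dephasing channel `Δ`. -/
def dephase (d n : ℕ) (A : QOp d n) : QOp d n :=
  Matrix.diagonal (fun i => A i i)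

/-- The diagonal matrix `log₂ Δ(ρ)` (entrywise base-2 logarithm of the diagonal). -/
def logDephase (d n : ℕ) (A : QOp d n) : QOp d n :=
  Matrix.diagonal (fun i => (Real.logb 2 (A i i).re : ℂ))

/-- The coherence rate `R_C(H,ρ) = -i Tr([ρ, log Δ(ρ)] H)`. -/
def cohRate (d n : ℕ) (H ρ : QOp d n) : ℂ :=
  -Complex.I * ((ρ * logDephase d n ρ - logDephase d n ρ * ρ) * H).trace

/-- The max-relative entropy `D_max(ρ‖σ) = log₂ min{λ > 0 : ρ ≤ λσ}`. -/
def Dmax (d n : ℕ) (ρ σ : QOp d n) : ℝ :=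
  Real.logb 2 (sInf {l : ℝ | 0 < l ∧ ((l : ℂ) • σ - ρ).PosSemidef})

lemma cast_fin_inj {d : ℕ} [NeZero d] {x y : Fin d} :
    ((x : ℕ) : ZMod d) = ((y : ℕ) : ZMod d) ↔ x = y := by
  rw [ZMod.natCast_eq_natCast_iff', Nat.mod_eq_of_lt x.2, Nat.mod_eq_of_lt y.2, Fin.ext_iff]

lemma shiftX_pow_apply (d : ℕ) [NeZero d] (k : ℕ) (i j : Fin d) :
    (shiftX d ^ k) i j = if ((i : ℕ) : ZMod d) = (j : ℕ) + k then 1 else 0 := by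
  induction k generalizing i with
  | zero => simp [Matrix.one_apply, cast_fin_inj]
  | succ k ih =>
    have hd : ((d - 1 : ℕ) : ZMod d) = -1 := by
      rw [Nat.cast_sub (Nat.one_le_iff_ne_zero.2 (NeZero.ne d))]; simp
    have h (l : Fin d) : shiftX d i l = if l = Fin.ofNat d (i + (d - 1)) then 1 else 0 := by
      unfold shiftX
      congr 1
      rw [← cast_fin_inj (x := l), ← Nat.mod_eq_of_lt i.2, ← Nat.ModEq,
        ← ZMod.natCast_eq_natCast_iff]
      simp only [Fin.val_ofNat, ZMod.natCast_mod, Nat.cast_add, hd, Nat.cast_one]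
      exact propext ⟨fun h => by rw [h]; ring, fun h => by rw [h]; ring⟩
    rw [pow_succ', Matrix.mul_apply]
    simp only [h, ite_mul, one_mul, zero_mul, Finset.sum_ite_eq', Finset.mem_univ, if_true, ih]
    simp only [Fin.val_ofNat, ZMod.natCast_mod, Nat.cast_add, hd, Nat.cast_one]
    congr 1
    exact propext ⟨fun h => by linear_combination h, fun h => by linear_combination h⟩

lemma pauli1_apply (d : ℕ) [NeZero d] (a : ZMod d × ZMod d) (x y : Fin d) :
    pauli1 d a x y = if a.1 = ((x : ℕ) : ZMod d) - (y : ℕ) then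
      ZMod.stdAddChar (a.2 * ((y : ℕ) : ZMod d)) else 0 := by
  have h : Complex.exp (2 * Real.pi * Complex.I * (y : ℕ) / d) ^ a.2.val =
      ZMod.stdAddChar (a.2 * ((y : ℕ) : ZMod d)) := by
    have := ZMod.stdAddChar_coe (N := d) ((a.2.val * y : ℕ) : ℤ)
    rw [Int.cast_natCast, Nat.cast_mul, ZMod.natCast_zmod_val] at this
    rw [this, ← Complex.exp_nat_mul]
    congr 1
    push_cast
    ring
  rw [pauli1, clockZ, Matrix.diagonal_pow, Matrix.mul_diagonal, shiftX_pow_apply, Pi.pow_apply, h,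
    ZMod.natCast_zmod_val, ite_mul, one_mul, zero_mul]
  congr 1
  exact propext ⟨fun h => by linear_combination -h, fun h => by linear_combination -h⟩

lemma sum_pauli1_mul_conj (d : ℕ) [NeZero d] (x y x' y' : Fin d) :
    ∑ a, pauli1 d a x y * star (pauli1 d a x' y') =
      if x = x' ∧ y = y' then (d : ℂ) else 0 := by
  have key : ∑ t : ZMod d, ZMod.stdAddChar (t * ((y : ℕ) : ZMod d)) *
      star (ZMod.stdAddChar (t * ((y' : ℕ) : ZMod d))) = if y = y' then (d : ℂ) else 0 := by
    have := AddChar.sum_mulShift (((y : ℕ) : ZMod d) - (y' : ℕ)) (ZMod.isPrimitive_stdAddChar d)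
    simp only [sub_eq_zero, cast_fin_inj, ZMod.card] at this
    rw [← (by push_cast; rfl : ((if y = y' then d else 0 : ℕ) : ℂ) = if y = y' then (d : ℂ) else 0),
      ← this]
    refine Finset.sum_congr rfl fun t _ => ?_
    rw [mul_sub, sub_eq_add_neg, AddChar.map_add_eq_mul, AddChar.map_neg_eq_conj]
    rfl
  simp only [pauli1_apply, Fintype.sum_prod_type, apply_ite star, star_zero, mul_ite, ite_mul,
    zero_mul, mul_zero]
  by_cases hy : y = y'
  · subst hy
    by_cases hx : x = x'
    · subst hx
      rw [if_pos rfl] at key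
      simpa [Finset.sum_ite_irrel] using key
    · have : ((x : ℕ) : ZMod d) - (y : ℕ) ≠ ((x' : ℕ) : ZMod d) - (y : ℕ) := by
        simpa [cast_fin_inj] using hx
      simp only [hx, false_and, if_false]
      refine Finset.sum_eq_zero fun s _ => Finset.sum_eq_zero fun t _ => ?_
      split_ifs with h1 h2 <;> simp_all
  · simp only [hy, and_false, if_false] at key ⊢
    refine Finset.sum_eq_zero fun s _ => ?_
    split_ifs <;> first | exact key | exact Finset.sum_const_zero

lemma sum_pauliN_mul_conj (d n : ℕ) [NeZero d] (x y x' y' : Fin n → Fin d) :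
    ∑ a, pauliN d n a x y * star (pauliN d n a x' y') =
      if x = x' ∧ y = y' then (d : ℂ) ^ n else 0 := by
  simp only [pauliN, star_prod, ← Finset.prod_mul_distrib]
  rw [← Fintype.prod_sum (fun i a => pauli1 d a (x i) (y i) * star (pauli1 d a (x' i) (y' i)))]
  simp only [sum_pauli1_mul_conj]
  split_ifs with h
  · simp [h.1, h.2]
  · have : ∃ i, ¬ (x i = x' i ∧ y i = y' i) := by
      by_contra! hc
      exact h ⟨funext fun i => (hc i).1, funext fun i => (hc i).2⟩
    obtain ⟨i, hi⟩ := this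
    exact Finset.prod_eq_zero (Finset.mem_univ i) (if_neg hi)

/-- Parseval's identity for the Pauli expansion. -/
lemma sum_norm_trace_sq (d n : ℕ) [NeZero d] (O : QOp d n) :
    ∑ a, ((‖(O * pauliN d n a).trace‖ ^ 2 : ℝ) : ℂ) = (d : ℂ) ^ n * (Oᴴ * O).trace := by
  have htr (a) : (O * pauliN d n a).trace =
      ∑ p : (Fin n → Fin d) × (Fin n → Fin d), O p.1 p.2 * pauliN d n a p.2 p.1 := by
    simp [Matrix.trace, Matrix.mul_apply, Fintype.sum_prod_type]
  have hO : (Oᴴ * O).trace =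
      ∑ p : (Fin n → Fin d) × (Fin n → Fin d), O p.1 p.2 * star (O p.1 p.2) := by
    rw [Fintype.sum_prod_type, Finset.sum_comm]
    simp [Matrix.trace, Matrix.mul_apply, mul_comm]
  calc ∑ a, ((‖(O * pauliN d n a).trace‖ ^ 2 : ℝ) : ℂ)
      = ∑ a, ∑ p : (Fin n → Fin d) × (Fin n → Fin d),
          ∑ q : (Fin n → Fin d) × (Fin n → Fin d), O p.1 p.2 * star (O q.1 q.2) *
            (pauliN d n a p.2 p.1 * star (pauliN d n a q.2 q.1)) := by
        refine Finset.sum_congr rfl fun a _ => ?_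
        rw [Complex.ofReal_pow, ← Complex.mul_conj', htr, map_sum,
          Finset.sum_mul_sum]
        refine Finset.sum_congr rfl fun p _ => Finset.sum_congr rfl fun q _ => ?_
        simp only [map_mul, starRingEnd_apply]
        ring
    _ = ∑ p : (Fin n → Fin d) × (Fin n → Fin d), ∑ q : (Fin n → Fin d) × (Fin n → Fin d),
          O p.1 p.2 * star (O q.1 q.2) * if p = q then (d : ℂ) ^ n else 0 := by
        rw [Finset.sum_comm]
        refine Finset.sum_congr rfl fun p _ => ?_
        rw [Finset.sum_comm]
        refine Finset.sum_congr rfl fun q _ => ?_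
        rw [← Finset.mul_sum, sum_pauliN_mul_conj]
        simp only [Prod.ext_iff, and_comm]
    _ = _ := by
        simp only [mul_ite, mul_zero, Finset.sum_ite_eq, Finset.mem_univ, if_true, hO,
          Finset.mul_sum]
        exact Finset.sum_congr rfl fun p _ => by ring

lemma pdist_nonneg (d n : ℕ) (O : QOp d n) (a : Fin n → ZMod d × ZMod d) :
    0 ≤ pdist d n O a := by
  unfold pdist; positivity

lemma sum_pdist (d n : ℕ) [NeZero d] (O : QOp d n) :
    ∑ a, pdist d n O a = ((Oᴴ * O).trace).re / (d : ℝ) ^ n := by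
  have hd : (d : ℝ) ^ n ≠ 0 := pow_ne_zero _ (Nat.cast_ne_zero.2 (NeZero.ne d))
  have h := congrArg Complex.re (sum_norm_trace_sq d n O)
  rw [← Complex.ofReal_sum, Complex.ofReal_re, ← Complex.ofReal_natCast, ← Complex.ofReal_pow,
    Complex.re_ofReal_mul] at h
  simp only [pdist, ← Finset.sum_div, h]
  rw [two_mul, pow_add]
  field_simp

lemma l2norm_eq_one_iff (d n : ℕ) [NeZero d] (O : QOp d n) :
    l2norm d n O = 1 ↔ ∑ a, pdist d n O a = 1 := by
  rw [l2norm, sum_pdist, Real.sqrt_eq_one]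

lemma pauliN_zero (d n : ℕ) [NeZero d] : pauliN d n 0 = 1 := by
  ext x y
  simp only [pauliN, pauli1, Pi.zero_apply, Prod.fst_zero, Prod.snd_zero, ZMod.val_zero, pow_zero,
    mul_one, Matrix.one_apply, Finset.prod_ite_zero, Finset.prod_const_one, Finset.mem_univ,
    true_implies, funext_iff]

lemma pdist_zero (d n : ℕ) [NeZero d] (O : QOp d n) :
    pdist d n O 0 = ‖O.trace‖ ^ 2 / (d : ℝ) ^ (2 * n) := by
  rw [pdist, pauliN_zero, mul_one]

lemma trace_one_qop (d n : ℕ) : (1 : QOp d n).trace = (d : ℂ) ^ n := by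
  simp [Matrix.trace_one]

lemma trace_pauliN_of_ne_zero (d n : ℕ) [NeZero d] {a : Fin n → ZMod d × ZMod d} (ha : a ≠ 0) :
    (pauliN d n a).trace = 0 := by
  have hd : (d : ℝ) ^ n ≠ 0 := pow_ne_zero _ (Nat.cast_ne_zero.2 (NeZero.ne d))
  have h1 : ∑ a, pdist d n 1 a = 1 := by
    rw [sum_pdist, conjTranspose_one, mul_one, trace_one_qop, ← Complex.ofReal_natCast,
      ← Complex.ofReal_pow, Complex.ofReal_re, div_self hd]
  have h0 : pdist d n 1 0 = 1 := by
    rw [pdist_zero, trace_one_qop, norm_pow, Complex.norm_natCast, ← pow_mul, mul_comm n 2,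
      div_self (by rw [mul_comm, pow_mul]; exact pow_ne_zero _ hd)]
  rw [← Finset.add_sum_erase _ _ (Finset.mem_univ 0), h0, add_eq_left,
    Finset.sum_eq_zero_iff_of_nonneg fun b _ => pdist_nonneg d n 1 b] at h1
  have h := h1 a (Finset.mem_erase.2 ⟨ha, Finset.mem_univ a⟩)
  rw [pdist, one_mul, mul_comm, pow_mul] at h
  simpa [NeZero.ne d] using h

/-- The traceless part of `O`, rescaled by `1 / √(1 - P_O[0])`. -/
def tracelessPart (d n : ℕ) [NeZero d] (O : QOp d n) : QOp d n :=
  ((Real.sqrt (1 - pdist d n O 0) : ℝ) : ℂ)⁻¹ • (O - (O.trace / (d : ℂ) ^ n) • 1)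

lemma trace_tracelessPart (d n : ℕ) [NeZero d] (O : QOp d n) :
    (tracelessPart d n O).trace = 0 := by
  have hd : (d : ℂ) ^ n ≠ 0 := pow_ne_zero _ (Nat.cast_ne_zero.2 (NeZero.ne d))
  rw [tracelessPart, trace_smul, trace_sub, trace_smul, trace_one_qop, smul_eq_mul (_ / _),
    div_mul_cancel₀ _ hd, sub_self, smul_zero]

lemma pdist_tracelessPart_zero (d n : ℕ) [NeZero d] (O : QOp d n) :
    pdist d n (tracelessPart d n O) 0 = 0 := by
  simp [pdist_zero, trace_tracelessPart]

lemma pdist_eq_mul_tracelessPart (d n : ℕ) [NeZero d] (O : QOp d n) (hO : pdist d n O 0 < 1)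
    {a : Fin n → ZMod d × ZMod d} (ha : a ≠ 0) :
    pdist d n O a = (1 - pdist d n O 0) * pdist d n (tracelessPart d n O) a := by
  have hq : 0 < 1 - pdist d n O 0 := sub_pos.2 hO
  have h : (tracelessPart d n O * pauliN d n a).trace =
      ((Real.sqrt (1 - pdist d n O 0) : ℝ) : ℂ)⁻¹ * (O * pauliN d n a).trace := by
    rw [tracelessPart, smul_mul_assoc, trace_smul, sub_mul, trace_sub, smul_mul_assoc, trace_smul,
      one_mul, trace_pauliN_of_ne_zero d n ha, smul_zero, sub_zero, smul_eq_mul]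
  rw [pdist, pdist.eq_1 d n (tracelessPart d n O), h, norm_mul, norm_inv, Complex.norm_real,
    mul_pow, inv_pow, Real.norm_eq_abs, sq_abs, Real.sq_sqrt hq.le, mul_div_assoc,
    mul_inv_cancel_left₀ hq.ne']

lemma sum_erase_pdist_tracelessPart (d n : ℕ) [NeZero d] (O : QOp d n) (h1 : l2norm d n O = 1)
    (hO : pdist d n O 0 < 1) :
    ∑ a ∈ Finset.univ.erase 0, pdist d n (tracelessPart d n O) a = 1 := by
  rw [l2norm_eq_one_iff, ← Finset.add_sum_erase _ _ (Finset.mem_univ 0), Finset.sum_congr rfl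
    fun a ha => pdist_eq_mul_tracelessPart d n O hO (Finset.ne_of_mem_erase ha),
    ← Finset.mul_sum] at h1
  refine mul_left_cancel₀ (sub_pos.2 hO).ne' ?_
  linear_combination h1

lemma l2norm_tracelessPart (d n : ℕ) [NeZero d] (O : QOp d n) (h1 : l2norm d n O = 1)
    (hO : pdist d n O 0 < 1) : l2norm d n (tracelessPart d n O) = 1 := by
  rw [l2norm_eq_one_iff, ← Finset.add_sum_erase _ _ (Finset.mem_univ 0),
    pdist_tracelessPart_zero, zero_add, sum_erase_pdist_tracelessPart d n O h1 hO]

/-- The chain rule for the Fourier entropy: `H[O] = h(q) + (1 - q) H[O']`, where `q = P_O[0]` and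
`O'` is the normalized traceless part of `O`. -/
lemma qEntropy_eq_binEntropy_add (d n : ℕ) [NeZero d] (O : QOp d n) (h1 : l2norm d n O = 1)
    (hO : pdist d n O 0 < 1) :
    qEntropy d n O = binEntropy (pdist d n O 0) +
      (1 - pdist d n O 0) * qEntropy d n (tracelessPart d n O) := by
  have hs := sum_erase_pdist_tracelessPart d n O h1 hO
  have hp := fun a (ha : a ∈ Finset.univ.erase (0 : Fin n → ZMod d × ZMod d)) =>
    pdist_eq_mul_tracelessPart d n O hO (Finset.ne_of_mem_erase ha)
  rw [qEntropy, qEntropy, binEntropy, ← Finset.add_sum_erase _ _ (Finset.mem_univ 0),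
    ← Finset.add_sum_erase (a := 0) _
      (fun a => pdist d n (tracelessPart d n O) a * Real.logb 2 (pdist d n (tracelessPart d n O) a))
      (Finset.mem_univ 0), pdist_tracelessPart_zero]
  generalize pdist d n O 0 = q at *
  have hq : 1 - q ≠ 0 := (sub_pos.2 hO).ne'
  have hterm : ∀ a ∈ Finset.univ.erase (0 : Fin n → ZMod d × ZMod d),
      pdist d n O a * Real.logb 2 (pdist d n O a) =
      (1 - q) * Real.logb 2 (1 - q) * pdist d n (tracelessPart d n O) a + (1 - q) *
        (pdist d n (tracelessPart d n O) a * Real.logb 2 (pdist d n (tracelessPart d n O) a)) := by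
    intro a ha
    rw [hp a ha]
    by_cases h0 : pdist d n (tracelessPart d n O) a = 0
    · simp [h0]
    · rw [Real.logb_mul hq h0]
      ring
  rw [Finset.sum_congr rfl hterm, Finset.sum_add_distrib, ← Finset.mul_sum, ← Finset.mul_sum, hs]
  ring

lemma pdist_zero_le_one (d n : ℕ) [NeZero d] (O : QOp d n) (h1 : l2norm d n O = 1) :
    pdist d n O 0 ≤ 1 :=
  (l2norm_eq_one_iff d n O).1 h1 ▸
    Finset.single_le_sum (fun a _ => pdist_nonneg d n O a) (Finset.mem_univ 0)

lemma qEntropy_eq_zero (d n : ℕ) [NeZero d] (O : QOp d n) (h1 : l2norm d n O = 1)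
    (hO : pdist d n O 0 = 1) : qEntropy d n O = 0 := by
  rw [l2norm_eq_one_iff, ← Finset.add_sum_erase _ _ (Finset.mem_univ 0), hO, add_eq_left,
    Finset.sum_eq_zero_iff_of_nonneg fun b _ => pdist_nonneg d n O b] at h1
  rw [qEntropy, neg_eq_zero]
  refine Finset.sum_eq_zero fun a _ => ?_
  by_cases ha : a = 0
  · rw [ha, hO, Real.logb_one, mul_zero]
  · rw [h1 a (Finset.mem_erase.2 ⟨ha, Finset.mem_univ a⟩), zero_mul]

section Conjugation

variable {d n : ℕ} {U : QOp d n}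

lemma trace_unitary_conj (hU : U ∈ Matrix.unitaryGroup (Fin n → Fin d) ℂ) (O : QOp d n) :
    (U * O * Uᴴ).trace = O.trace := by
  rw [trace_mul_cycle, ← star_eq_conjTranspose, mem_unitaryGroup_iff'.1 hU, one_mul]

lemma l2norm_unitary_conj (hU : U ∈ Matrix.unitaryGroup (Fin n → Fin d) ℂ) (O : QOp d n) :
    l2norm d n (U * O * Uᴴ) = l2norm d n O := by
  have h : (U * O * Uᴴ)ᴴ * (U * O * Uᴴ) = U * (Oᴴ * O) * Uᴴ := by
    have hU' : Uᴴ * U = 1 := mem_unitaryGroup_iff'.1 hU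
    rw [conjTranspose_mul, conjTranspose_mul, conjTranspose_conjTranspose]
    calc U * (Oᴴ * Uᴴ) * (U * O * Uᴴ) = U * (Oᴴ * (Uᴴ * U) * O) * Uᴴ := by
          simp only [mul_assoc]
      _ = _ := by rw [hU', mul_one]
  rw [l2norm, h, trace_unitary_conj hU, l2norm]

lemma tracelessPart_unitary_conj [NeZero d] (hU : U ∈ Matrix.unitaryGroup (Fin n → Fin d) ℂ)
    (O : QOp d n) : tracelessPart d n (U * O * Uᴴ) = U * tracelessPart d n O * Uᴴ := by
  have hU' : U * Uᴴ = 1 := mem_unitaryGroup_iff.1 hU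
  simp only [tracelessPart, pdist_zero, trace_unitary_conj hU, mul_smul_comm, smul_mul_assoc,
    mul_sub, sub_mul, mul_one, hU']

end Conjugation

lemma exists_l2norm_eq_one_trace_eq_zero (d n : ℕ) (hn : 1 ≤ n) (hd : 2 ≤ d) [NeZero d] :
    ∃ O : QOp d n, l2norm d n O = 1 ∧ O.trace = 0 := by
  have : Nontrivial (Fin d) := Fin.nontrivial_iff_two_le.2 hd
  have : Nonempty (Fin n) := ⟨⟨0, hn⟩⟩
  obtain ⟨x, y, hxy⟩ := exists_pair_ne (Fin n → Fin d)
  have hd' : (d : ℝ) ^ n ≠ 0 := pow_ne_zero _ (Nat.cast_ne_zero.2 (NeZero.ne d))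
  refine ⟨Matrix.single x y ((Real.sqrt ((d : ℝ) ^ n) : ℝ) : ℂ), ?_,
    Matrix.trace_single_eq_of_ne _ _ _ hxy⟩
  rw [l2norm, conjTranspose_single, single_mul_single_same, trace_single_eq_same, Complex.star_def,
    Complex.conj_ofReal, ← Complex.ofReal_mul, Complex.ofReal_re,
    Real.mul_self_sqrt (by positivity), div_self hd', Real.sqrt_one]

/-- The magic power is attained on traceless operators. -/
theorem magicPower_eq_sSup_traceless (n d : ℕ) (hn : 1 ≤ n) (hd : 2 ≤ d) [NeZero d]
    (U : QOp d n) (hU : U ∈ Matrix.unitaryGroup (Fin n → Fin d) ℂ) :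
    sSup {x : ℝ | ∃ O : QOp d n, l2norm d n O = 1 ∧
        x = |qEntropy d n (U * O * Uᴴ) - qEntropy d n O|} =
    sSup {x : ℝ | ∃ O : QOp d n, l2norm d n O = 1 ∧ O.trace = 0 ∧
        x = |qEntropy d n (U * O * Uᴴ) - qEntropy d n O|} := by
  refine csSup_eq_csSup_of_forall_exists_le ?_ ?_
  · rintro _ ⟨O, h1, rfl⟩
    have h1' := (l2norm_unitary_conj hU O).trans h1
    have hq : pdist d n (U * O * Uᴴ) 0 = pdist d n O 0 := by
      rw [pdist_zero, pdist_zero, trace_unitary_conj hU]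
    rcases (pdist_zero_le_one d n O h1).lt_or_eq with hO | hO
    · refine ⟨_, ⟨tracelessPart d n O, l2norm_tracelessPart d n O h1 hO,
        trace_tracelessPart d n O, rfl⟩, ?_⟩
      rw [qEntropy_eq_binEntropy_add d n O h1 hO,
        qEntropy_eq_binEntropy_add d n _ h1' (hq.trans_lt hO), hq, tracelessPart_unitary_conj hU,
        add_sub_add_left_eq_sub, ← mul_sub, abs_mul, abs_of_pos (sub_pos.2 hO)]
      exact mul_le_of_le_one_left (abs_nonneg _) (sub_le_self _ (pdist_nonneg d n O 0))
    · obtain ⟨T, hT1, hT0⟩ := exists_l2norm_eq_one_trace_eq_zero d n hn hd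
      refine ⟨_, ⟨T, hT1, hT0, rfl⟩, ?_⟩
      rw [qEntropy_eq_zero d n O h1 hO, qEntropy_eq_zero d n _ h1' (hq.trans hO), sub_zero,
        abs_zero]
      exact abs_nonneg _
  · rintro x ⟨O, h1, -, hx⟩
    exact ⟨x, ⟨O, h1, hx⟩, le_rfl⟩

end QC
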